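/- Let f and g be functions on Σ_n with f ∼ (y^1)^{k_1}⋯(y^n)^{k_n} and g ∼ (y^1)^{m_1}⋯(y^n)^{m_n} on Σ_n for integer vectors k, m ∈ ℤ^n (i.e., f and g have monomial growth on Σ_n). Suppose that for every ĵ ∈ {1, …, n} there exist real numbers e^1 ≥ e^2 ≥ ⋯ ≥ e^{ĵ} > 0 and a base point (x_0, y_0) with 0 < x_0^k < 1 and y_0^1 > y_0^2 > ⋯ > y_0^n > 1 such that, along the path γ(σ) = (x_0, y_0^1 + e^1 σ, …, y_0^{ĵ} + e^{ĵ} σ, y_0^{ĵ+1}, …, y_0^n) — which lies in Σ_n for all σ ≥ 0 — one has f∘γ ∼ g∘γ on [0, ∞). Then k_1 + ⋯ + k_{ĵ} = m_1 + ⋯ + m_{ĵ} for every ĵ ∈ {1, …, n}; hence k = m and f ∼ g on all of Σ_n. -/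

import Mathlib

namespace TamePaper

noncomputable section

/-- The point space: `n` pairs of real coordinates `(x, y)`. -/
abbrev Pt (n : ℕ) := (Fin n → ℝ) × (Fin n → ℝ)

/-- The growth sector `Σ_n = {0 < xᵏ < 1, y¹ ≥ y² ≥ ⋯ ≥ yⁿ > 1}`. -/
def GrowthSector (n : ℕ) : Set (Pt n) :=
  {p | (∀ k, 0 < p.1 k ∧ p.1 k < 1) ∧
       (∀ k l : Fin n, k ≤ l → p.2 l ≤ p.2 k) ∧ (∀ k, 1 < p.2 k)}

/-- `f ≺ g` on `S`: there is `C > 0` with `f < C·g` everywhere on `S`. -/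
def Prec {α : Type*} (S : Set α) (f g : α → ℝ) : Prop :=
  ∃ C : ℝ, 0 < C ∧ ∀ p ∈ S, f p < C * g p

/-- `f ∼ g` on `S`: `C₁·g < f < C₂·g` on `S` for two constants of the same sign. -/
def Sim {α : Type*} (S : Set α) (f g : α → ℝ) : Prop :=
  ∃ C₁ C₂ : ℝ, 0 < C₁ * C₂ ∧ ∀ p ∈ S, C₁ * g p < f p ∧ f p < C₂ * g p

/-- The monomial `(y¹)^{m₁} ⋯ (yⁿ)^{mₙ}`. -/
def monomial (n : ℕ) (m : Fin n → ℤ) : Pt n → ℝ := fun p => ∏ k, p.2 k ^ m k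

/-- The linear path `γ(σ)` with base point `(x₀, y₀)` that moves the first `ĵ`
saxions as `y₀ᵃ + eᵃ σ` and keeps the others fixed. -/
def linPath (n : ℕ) (jhat : ℕ) (e x₀ y₀ : Fin n → ℝ) (σ : ℝ) : Pt n :=
  (x₀, fun a => if (a : ℕ) < jhat then y₀ a + e a * σ else y₀ a)

lemma sim_sign {α : Type*} (S : Set α) (f g : α → ℝ) (t : ℝ) (ht : t = 1 ∨ t = -1)
    (h : Sim S f g) (hg : ∀ p ∈ S, 0 < t * g p) :
    ∃ s c d : ℝ, (s = 1 ∨ s = -1) ∧ 0 < c ∧ 0 < d ∧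
      ∀ p ∈ S, c * (t * g p) < s * f p ∧ s * f p < d * (t * g p) := by
  obtain ⟨C₁, C₂, hC, h⟩ := h
  rcases ht with rfl | rfl
  · rcases mul_pos_iff.1 hC with ⟨h1, h2⟩ | ⟨h1, h2⟩
    · exact ⟨1, C₁, C₂, Or.inl rfl, h1, h2, fun p hp => by
        have := h p hp; constructor <;> linarith⟩
    · exact ⟨-1, -C₂, -C₁, Or.inr rfl, by linarith, by linarith, fun p hp => by
        have := h p hp; constructor <;> linarith⟩
  · rcases mul_pos_iff.1 hC with ⟨h1, h2⟩ | ⟨h1, h2⟩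
    · exact ⟨-1, C₂, C₁, Or.inr rfl, h2, h1, fun p hp => by
        have := h p hp; constructor <;> linarith⟩
    · exact ⟨1, -C₁, -C₂, Or.inl rfl, by linarith, by linarith, fun p hp => by
        have := h p hp; constructor <;> linarith⟩

lemma sim_of_sign {α : Type*} (S : Set α) (f g : α → ℝ) (s t c d : ℝ)
    (hs : s = 1 ∨ s = -1) (ht : t = 1 ∨ t = -1) (hc : 0 < c) (hd : 0 < d)
    (h : ∀ p ∈ S, c * (t * g p) < s * f p ∧ s * f p < d * (t * g p)) : Sim S f g := by
  have hcd := mul_pos hc hd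
  rcases hs with rfl | rfl <;> rcases ht with rfl | rfl
  · exact ⟨c, d, by nlinarith, fun p hp => by have := h p hp; constructor <;> linarith⟩
  · exact ⟨-c, -d, by nlinarith, fun p hp => by have := h p hp; constructor <;> linarith⟩
  · exact ⟨-d, -c, by nlinarith, fun p hp => by have := h p hp; constructor <;> linarith⟩
  · exact ⟨d, c, by nlinarith, fun p hp => by have := h p hp; constructor <;> linarith⟩

lemma monomial_pos (n : ℕ) (m : Fin n → ℤ) (p : Pt n) (hp : p ∈ GrowthSector n) :
    0 < monomial n m p :=
  Finset.prod_pos fun a _ => zpow_pos (by linarith [hp.2.2 a]) _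

lemma path_mem (n j : ℕ) (e x₀ y₀ : Fin n → ℝ)
    (he : ∀ a b : Fin n, a ≤ b → (b : ℕ) < j → e b ≤ e a)
    (he0 : ∀ a : Fin n, (a : ℕ) < j → 0 < e a)
    (hx : ∀ a, 0 < x₀ a ∧ x₀ a < 1)
    (hy : ∀ a b : Fin n, a < b → y₀ b < y₀ a) (hy1 : ∀ a, 1 < y₀ a) (σ : ℝ) (hσ : 0 ≤ σ) :
    linPath n j e x₀ y₀ σ ∈ GrowthSector n := by
  refine ⟨hx, fun a b hab => ?_, fun a => ?_⟩
  · have h1 : y₀ b ≤ y₀ a := by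
      rcases hab.eq_or_lt with rfl | h
      · exact le_rfl
      · exact (hy a b h).le
    have hab' : (a : ℕ) ≤ b := hab
    simp only [linPath]
    by_cases hb : (b : ℕ) < j
    · rw [if_pos hb, if_pos (lt_of_le_of_lt hab' hb)]
      have := mul_le_mul_of_nonneg_right (he a b hab hb) hσ
      linarith
    · rw [if_neg hb]
      split_ifs with ha
      · have := mul_nonneg (he0 a ha).le hσ
        linarith
      · exact h1
  · simp only [linPath]
    split_ifs with ha
    · have := mul_nonneg (he0 a ha).le hσ
      linarith [hy1 a]
    · exact hy1 a

open Filter Topology in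
lemma deg_le (n j : ℕ) (e x₀ y₀ : Fin n → ℝ) (d : Fin n → ℤ) (B : ℝ)
    (he0 : ∀ a : Fin n, (a : ℕ) < j → 0 < e a) (hy1 : ∀ a, 1 < y₀ a)
    (hB : ∀ σ : ℝ, 0 ≤ σ → monomial n d (linPath n j e x₀ y₀ σ) ≤ B) :
    ∑ a ∈ Finset.univ.filter (fun a : Fin n => (a : ℕ) < j), d a ≤ 0 := by
  by_contra hD
  push Not at hD
  set D := ∑ a ∈ Finset.univ.filter (fun a : Fin n => (a : ℕ) < j), d a with hDdef
  have hlim : Tendsto (fun σ : ℝ => ∏ a : Fin n,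
      (if (a : ℕ) < j then (y₀ a / σ + e a) ^ d a else y₀ a ^ d a)) atTop
      (𝓝 (∏ a : Fin n, (if (a : ℕ) < j then (e a) ^ d a else y₀ a ^ d a))) := by
    refine tendsto_finsetProd _ fun a _ => ?_
    split_ifs with ha
    · have h1 : Tendsto (fun σ : ℝ => y₀ a / σ + e a) atTop (𝓝 (e a)) := by
        have := (tendsto_const_nhds (x := y₀ a)).div_atTop (tendsto_id (α := ℝ))
        simpa using this.add_const (e a)
      exact h1.zpow₀ _ (Or.inl (he0 a ha).ne')
    · exact tendsto_const_nhds
  have hL : 0 < ∏ a : Fin n, (if (a : ℕ) < j then (e a) ^ d a else y₀ a ^ d a) := by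
    refine Finset.prod_pos fun a _ => ?_
    split_ifs with ha
    · exact zpow_pos (he0 a ha) _
    · exact zpow_pos (by linarith [hy1 a]) _
  have hpow : Tendsto (fun σ : ℝ => σ ^ D) atTop atTop := by
    obtain ⟨N, hN⟩ := Int.eq_ofNat_of_zero_le hD.le
    rw [hN]
    simp only [zpow_natCast]
    exact tendsto_pow_atTop (by omega)
  have hT := hpow.atTop_mul_pos hL hlim
  obtain ⟨σ, h1, h2⟩ := ((hT.eventually_gt_atTop B).and (eventually_gt_atTop 0)).exists
  have h3 := hB σ h2.le
  refine absurd h1 (not_lt.2 (le_trans (le_of_eq ?_) h3))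
  have hσD : σ ^ D = ∏ a : Fin n, (if (a : ℕ) < j then σ ^ d a else 1) := by
    rw [← Finset.prod_filter, hDdef]
    generalize Finset.univ.filter (fun a : Fin n => (a : ℕ) < j) = T
    induction T using Finset.induction_on with
    | empty => simp
    | insert a T ha ih => rw [Finset.sum_insert ha, Finset.prod_insert ha, zpow_add₀ h2.ne', ih]
  simp only [monomial, linPath]
  rw [hσD, ← Finset.prod_mul_distrib]
  refine Finset.prod_congr rfl fun a _ => ?_
  split_ifs with ha
  · rw [← mul_zpow]
    congr 1
    field_simp
  · simp

lemma deg_le' (n j : ℕ) (e x₀ y₀ : Fin n → ℝ) (k m : Fin n → ℤ) (B : ℝ)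
    (he0 : ∀ a : Fin n, (a : ℕ) < j → 0 < e a) (hy1 : ∀ a, 1 < y₀ a)
    (hmem : ∀ σ : ℝ, 0 ≤ σ → linPath n j e x₀ y₀ σ ∈ GrowthSector n)
    (hB : ∀ σ : ℝ, 0 ≤ σ → monomial n k (linPath n j e x₀ y₀ σ) ≤
      B * monomial n m (linPath n j e x₀ y₀ σ)) :
    ∑ a ∈ Finset.univ.filter (fun a : Fin n => (a : ℕ) < j), k a ≤
    ∑ a ∈ Finset.univ.filter (fun a : Fin n => (a : ℕ) < j), m a := by
  have := deg_le n j e x₀ y₀ (fun a => k a - m a) B he0 hy1 fun σ hσ => by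
    have h1 := monomial_pos n m _ (hmem σ hσ)
    have h2 := hB σ hσ
    rw [← div_le_iff₀ h1] at h2
    refine le_trans (le_of_eq ?_) h2
    unfold monomial
    rw [← Finset.prod_div_distrib]
    refine Finset.prod_congr rfl fun a _ => ?_
    exact zpow_sub₀ (by linarith [(hmem σ hσ).2.2 a]) _ _
  rw [Finset.sum_sub_distrib] at this
  linarith

/-- Let `f ∼ (y¹)^{k₁}⋯(yⁿ)^{kₙ}` and `g ∼ (y¹)^{m₁}⋯(yⁿ)^{mₙ}`
on `Σ_n`. Suppose that for every `ĵ ∈ {1, …, n}` there are slopes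
`e¹ ≥ ⋯ ≥ e^{ĵ} > 0` and a base point `(x₀, y₀)` with `0 < x₀ᵏ < 1` and
`y₀¹ > ⋯ > y₀ⁿ > 1` such that `f∘γ ∼ g∘γ` on `[0, ∞)` along the corresponding
linear path `γ`. Then `k₁ + ⋯ + k_ĵ = m₁ + ⋯ + m_ĵ` for every `ĵ`; hence `k = m`
and `f ∼ g` on all of `Σ_n`. -/
theorem statement18 (n : ℕ) (hn : 1 ≤ n) (f g : Pt n → ℝ) (k m : Fin n → ℤ)
    (hf : Sim (GrowthSector n) f (monomial n k))
    (hg : Sim (GrowthSector n) g (monomial n m))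
    (hyp : ∀ jhat : ℕ, 1 ≤ jhat → jhat ≤ n →
      ∃ e x₀ y₀ : Fin n → ℝ,
        (∀ a b : Fin n, a ≤ b → (b : ℕ) < jhat → e b ≤ e a) ∧
        (∀ a : Fin n, (a : ℕ) < jhat → 0 < e a) ∧
        (∀ a, 0 < x₀ a ∧ x₀ a < 1) ∧
        (∀ a b : Fin n, a < b → y₀ b < y₀ a) ∧ (∀ a, 1 < y₀ a) ∧
        Sim (Set.Ici (0 : ℝ))
          (fun σ => f (linPath n jhat e x₀ y₀ σ))
          (fun σ => g (linPath n jhat e x₀ y₀ σ))) :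
    (∀ jhat : ℕ, 1 ≤ jhat → jhat ≤ n →
      (∑ a ∈ Finset.univ.filter (fun a : Fin n => (a : ℕ) < jhat), k a) =
        ∑ a ∈ Finset.univ.filter (fun a : Fin n => (a : ℕ) < jhat), m a) ∧
    k = m ∧ Sim (GrowthSector n) f g := by
  obtain ⟨s, c, d, hs, hc, hd, hF⟩ := sim_sign _ _ _ 1 (Or.inl rfl) hf fun p hp => by
    simpa using monomial_pos n k p hp
  obtain ⟨t, c', d', ht, hc', hd', hG⟩ := sim_sign _ _ _ 1 (Or.inl rfl) hg fun p hp => by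
    simpa using monomial_pos n m p hp
  simp only [one_mul] at hF hG
  have key : ∀ jhat : ℕ, 1 ≤ jhat → jhat ≤ n →
      (∑ a ∈ Finset.univ.filter (fun a : Fin n => (a : ℕ) < jhat), k a) =
        ∑ a ∈ Finset.univ.filter (fun a : Fin n => (a : ℕ) < jhat), m a := by
    intro j hj1 hjn
    obtain ⟨e, x₀, y₀, he, he0, hx, hy, hy1, hsim⟩ := hyp j hj1 hjn
    have hmem := path_mem n j e x₀ y₀ he he0 hx hy hy1
    obtain ⟨s', c'', d'', hs', hc'', hd'', hH⟩ := sim_sign _ _ _ t ht hsim fun σ hσ =>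
      lt_trans (mul_pos hc' (monomial_pos n m _ (hmem σ hσ))) (hG _ (hmem σ hσ)).1
    have hss : s' = s := by
      have h1 := hH 0 (Set.mem_Ici.2 le_rfl)
      have h2 := hF _ (hmem 0 le_rfl)
      have h3 := hG _ (hmem 0 le_rfl)
      have h4 := mul_pos hc (monomial_pos n k _ (hmem 0 le_rfl))
      have h5 := mul_pos hc' (monomial_pos n m _ (hmem 0 le_rfl))
      have h6 := mul_pos hc'' (h5.trans h3.1)
      rcases hs with rfl | rfl <;> rcases hs' with rfl | rfl <;> first | rfl | linarith
    subst hss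
    apply le_antisymm
    · refine deg_le' n j e x₀ y₀ k m (d'' * d' / c) he0 hy1 hmem fun σ hσ => ?_
      have h1 := (hF _ (hmem σ hσ)).1
      have h2 := (hH σ hσ).2
      have h3 := mul_lt_mul_of_pos_left (hG _ (hmem σ hσ)).2 hd''
      rw [div_mul_eq_mul_div, le_div_iff₀ hc]
      linarith
    · refine deg_le' n j e x₀ y₀ m k (d / (c'' * c')) he0 hy1 hmem fun σ hσ => ?_
      have h1 := (hF _ (hmem σ hσ)).2
      have h2 := (hH σ hσ).1
      have h3 := mul_lt_mul_of_pos_left (hG _ (hmem σ hσ)).1 hc''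
      rw [div_mul_eq_mul_div, le_div_iff₀ (mul_pos hc'' hc')]
      linarith
  have hkm : k = m := by
    funext a
    have h1 := key (a + 1) (by omega) (by omega)
    have hset : Finset.univ.filter (fun b : Fin n => (b : ℕ) < a + 1) =
        insert a (Finset.univ.filter (fun b : Fin n => (b : ℕ) < a)) := by
      ext b
      simp only [Finset.mem_filter, Finset.mem_univ, true_and, Finset.mem_insert, Fin.ext_iff]
      omega
    rw [hset, Finset.sum_insert (by simp), Finset.sum_insert (by simp)] at h1
    have h0 : (∑ b ∈ Finset.univ.filter (fun b : Fin n => (b : ℕ) < a), k b) =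
        ∑ b ∈ Finset.univ.filter (fun b : Fin n => (b : ℕ) < a), m b := by
      rcases Nat.eq_zero_or_pos (a : ℕ) with h | h
      · simp [h]
      · exact key a h a.2.le
    linarith
  refine ⟨key, hkm, ?_⟩
  subst hkm
  refine sim_of_sign _ f g s t (c / d') (d / c') hs ht (div_pos hc hd') (div_pos hd hc')
    fun p hp => ⟨?_, ?_⟩
  · refine lt_trans ?_ (hF p hp).1
    rw [div_mul_eq_mul_div, div_lt_iff₀ hd']
    have := mul_lt_mul_of_pos_left (hG p hp).2 hc
    linarith
  · refine lt_trans (hF p hp).2 ?_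
    rw [div_mul_eq_mul_div, lt_div_iff₀ hc']
    have := mul_lt_mul_of_pos_left (hG p hp).1 hd
    linarith

end

end TamePaper
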